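/- For all u, u' ∈ ℂ, the equality Θ₀(u)·Θ₁(u') = Θ₁(u)·Θ₀(u') holds if and only if u' − u ∈ Λ_τ or u' + u − (1 + τ) ∈ Λ_τ. (That is, the degree-two map Φ₁ : ℂ/Λ_τ → ℙ¹, u ↦ (Θ₀(u) : −Θ₁(u)), is a branched double cover whose fiber through u is {u, 1 + τ − u}.) -/

import Mathlib

open Complex

/-- `Θ₀(u) = θ[0,0](2u,2τ) = ∑_{m∈ℤ} exp(2πiτm² + 4πimu)`. -/
noncomputable def Th0 (τ u : ℂ) : ℂ :=
  ∑' m : ℤ, Complex.exp (2 * Real.pi * I * τ * (m : ℂ) ^ 2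
      + 4 * Real.pi * I * (m : ℂ) * u)

/-- `Θ₁(u) = θ[1/2,0](2u,2τ) = ∑_{m∈ℤ} exp(2πiτ(m+1/2)² + 4πi(m+1/2)u)`. -/
noncomputable def Th1 (τ u : ℂ) : ℂ :=
  ∑' m : ℤ, Complex.exp (2 * Real.pi * I * τ * ((m : ℂ) + 1 / 2) ^ 2
      + 4 * Real.pi * I * ((m : ℂ) + 1 / 2) * u)

/-- Membership in the lattice `Λ_τ = ℤ + ℤτ ⊂ ℂ`. -/
def inLattice (τ z : ℂ) : Prop := ∃ m n : ℤ, z = (m : ℂ) + (n : ℂ) * τ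

/-! ### Entire functions -/

/-- An entire function with periods `1` and `τ`, where `Im τ > 0`, is constant. -/
theorem eq_of_doubly_periodic {τ : ℂ} (hτ : 0 < τ.im) {f : ℂ → ℂ} (hf : Differentiable ℂ f)
    (h₁ : ∀ z, f (z + 1) = f z) (h₂ : ∀ z, f (z + τ) = f z) (z w : ℂ) : f z = f w := by
  have hK : IsCompact (f '' (Set.Icc (0 : ℝ) 1 ×ℂ Set.Icc (0 : ℝ) τ.im)) :=
    (isCompact_Icc.reProdIm isCompact_Icc).image hf.continuous
  refine hf.apply_eq_apply_of_bounded (hK.isBounded.subset ?_) z w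
  rintro _ ⟨z, rfl⟩
  set n : ℤ := ⌊z.im / τ.im⌋ with hn
  set m : ℤ := ⌊(z - n * τ).re⌋ with hm
  have p₁ : Function.Periodic f 1 := h₁
  have p₂ : Function.Periodic f τ := h₂
  refine ⟨z - n * τ - m * 1, ?_, by rw [p₁.sub_int_mul_eq, p₂.sub_int_mul_eq]⟩
  have him : (z - n * τ - m * 1).im = z.im - n * τ.im := by simp
  have hre : (z - n * τ - m * 1).re = (z - n * τ).re - m := by simp
  have a₁ := Int.floor_le (z.im / τ.im)
  have a₂ := (Int.lt_floor_add_one (z.im / τ.im)).le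
  rw [← hn, le_div_iff₀ hτ] at a₁
  rw [← hn, div_le_iff₀ hτ] at a₂
  have b₁ := Int.floor_le (z - n * τ).re
  have b₂ := (Int.lt_floor_add_one (z - n * τ).re).le
  rw [← hm] at b₁ b₂
  rw [mem_reProdIm, him, hre]
  exact ⟨⟨by linarith, by linarith⟩, ⟨by linarith, by linarith⟩⟩

/-- A nowhere vanishing entire function with constant multipliers along a lattice is an
exponential. -/
theorem exists_eq_exp_of_multipliers {τ : ℂ} (hτ : 0 < τ.im) {g : ℂ → ℂ}
    (hg : Differentiable ℂ g) (hg₀ : ∀ z, g z ≠ 0) {a b : ℂ} (h₁ : ∀ z, g (z + 1) = a * g z)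
    (h₂ : ∀ z, g (z + τ) = b * g z) : ∃ l : ℂ, ∀ z, g z = g 0 * exp (l * z) := by
  have hg' : Differentiable ℂ (deriv g) := hg.deriv
  have hd : ∀ {c w : ℂ}, (∀ z, g (z + w) = c * g z) → ∀ z, deriv g (z + w) = c * deriv g z := by
    intro c w h z
    rw [← deriv_comp_add_const, funext h, deriv_const_mul_field]
  have hq : ∀ {c w : ℂ}, (∀ z, g (z + w) = c * g z) →
      ∀ z, deriv g (z + w) / g (z + w) = deriv g z / g z := by
    intro c w h z
    have hc : c ≠ 0 := fun hc ↦ hg₀ (z + w) (by rw [h, hc, zero_mul])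
    rw [hd h, h, mul_div_mul_left _ _ hc]
  have hconst := eq_of_doubly_periodic hτ (hg'.div hg hg₀) (hq h₁) (hq h₂)
  refine ⟨deriv g 0 / g 0, fun z ↦ ?_⟩
  set l := deriv g 0 / g 0 with hl
  have hderiv : ∀ z, deriv g z = l * g z := fun z ↦ by
    have := hconst z 0
    simp only [Pi.div_apply] at this
    rw [hl, ← this, div_mul_cancel₀ _ (hg₀ z)]
  have key : ∀ z, HasDerivAt (fun z ↦ g z * exp (-(l * z))) 0 z := fun z ↦ by
    have h1 : HasDerivAt (fun z ↦ exp (-(l * z))) (exp (-(l * z)) * -(l * 1)) z :=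
      (((hasDerivAt_id z).const_mul l).neg).cexp
    refine ((hg z).hasDerivAt.mul h1).congr_deriv ?_
    rw [hderiv]; ring
  have := is_const_of_deriv_eq_zero (fun z ↦ (key z).differentiableAt) (fun z ↦ (key z).deriv) z 0
  simp only [mul_zero, neg_zero, exp_zero, mul_one] at this
  rw [← this, mul_assoc, ← exp_add, neg_add_cancel, exp_zero, mul_one]

/-- Two pairs of entire functions that are proportional at every point, the first having no common
zero, differ by an entire factor. -/
theorem exists_entire_factor {f₀ f₁ h₀ h₁ : ℂ → ℂ} (hf₀ : Differentiable ℂ f₀)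
    (hf₁ : Differentiable ℂ f₁) (hh₀ : Differentiable ℂ h₀) (hh₁ : Differentiable ℂ h₁)
    (hne : ∀ z, f₀ z ≠ 0 ∨ f₁ z ≠ 0) (h : ∀ z, f₀ z * h₁ z = f₁ z * h₀ z) :
    ∃ g : ℂ → ℂ, Differentiable ℂ g ∧ ∀ z, h₀ z = g z * f₀ z ∧ h₁ z = g z * f₁ z := by
  have hex : ∀ z, ∃ c, h₀ z = c * f₀ z ∧ h₁ z = c * f₁ z := fun z ↦ by
    rcases hne z with hz | hz
    · exact ⟨h₀ z / f₀ z, by field_simp, by field_simp; linear_combination h z⟩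
    · exact ⟨h₁ z / f₁ z, by field_simp; linear_combination -h z, by field_simp⟩
  choose g hg₀ hg₁ using hex
  refine ⟨g, fun z ↦ ?_, fun z ↦ ⟨hg₀ z, hg₁ z⟩⟩
  rcases hne z with hz | hz
  · refine ((hh₀ z).div (hf₀ z) hz).congr_of_eventuallyEq ?_
    filter_upwards [(hf₀ z).continuousAt.eventually_ne hz] with w hw
    simp only [Pi.div_apply]
    rw [hg₀ w, mul_div_cancel_right₀ _ hw]
  · refine ((hh₁ z).div (hf₁ z) hz).congr_of_eventuallyEq ?_
    filter_upwards [(hf₁ z).continuousAt.eventually_ne hz] with w hw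
    simp only [Pi.div_apply]
    rw [hg₁ w, mul_div_cancel_right₀ _ hw]

theorem entire_eq_zero_or_eq_zero {f g : ℂ → ℂ} (hf : Differentiable ℂ f)
    (hg : Differentiable ℂ g) (h : ∀ z, f z * g z = 0) : (∀ z, f z = 0) ∨ ∀ z, g z = 0 := by
  simpa using AnalyticOnNhd.eq_zero_or_eq_zero_of_mul_eq_zero (U := Set.univ)
    (fun z _ ↦ hf.analyticAt z) (fun z _ ↦ hg.analyticAt z) (fun z _ ↦ h z)
    isPreconnected_univ

/-! ### The Jacobi theta function -/

theorem summable_norm_jacobiTheta₂_term (z : ℂ) {τ : ℂ} (hτ : 0 < τ.im) :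
    Summable fun n : ℤ ↦ ‖jacobiTheta₂_term n z τ‖ :=
  ((summable_jacobiTheta₂_term_iff z τ).2 hτ).norm

/-- The zeroth Fourier coefficient of `jacobiTheta₂ · τ` is `1`. -/
theorem integral_jacobiTheta₂ {τ : ℂ} (hτ : 0 < τ.im) :
    ∫ x in (0 : ℝ)..1, jacobiTheta₂ x τ = 1 := by
  have hcont : ∀ n : ℤ, Continuous fun x : ℝ ↦ jacobiTheta₂_term n x τ := fun n ↦ by
    unfold jacobiTheta₂_term; fun_prop
  have hsum : HasSum (fun n : ℤ ↦ ∫ x in (0 : ℝ)..1, jacobiTheta₂_term n x τ)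
      (∫ x in (0 : ℝ)..1, jacobiTheta₂ x τ) := by
    refine intervalIntegral.hasSum_integral_of_dominated_convergence
      (fun n _ ↦ ‖jacobiTheta₂_term n 0 τ‖) (fun n ↦ (hcont n).aestronglyMeasurable) ?_ ?_ ?_ ?_
    · refine fun n ↦ .of_forall fun x _ ↦ le_of_eq ?_
      rw [norm_jacobiTheta₂_term, norm_jacobiTheta₂_term]
      simp
    · exact .of_forall fun x _ ↦ summable_norm_jacobiTheta₂_term 0 hτ
    · exact intervalIntegrable_const
    · exact .of_forall fun x _ ↦ hasSum_jacobiTheta₂_term x hτ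
  refine hsum.unique ?_
  have hterm : ∀ n : ℤ, n ≠ 0 → ∫ x in (0 : ℝ)..1, jacobiTheta₂_term n x τ = 0 := fun n hn ↦ by
    have hc : (2 * Real.pi * I * n : ℂ) ≠ 0 := by
      simp [Real.pi_ne_zero, hn]
    simp only [jacobiTheta₂_term, exp_add, intervalIntegral.integral_mul_const]
    rw [integral_exp_mul_complex hc]
    have : exp (2 * Real.pi * I * n) = 1 := by
      rw [mul_comm]; exact exp_int_mul_two_pi_mul_I n
    simp [this]
  convert hasSum_single (0 : ℤ) hterm using 1
  simp [jacobiTheta₂_term]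

theorem exists_jacobiTheta₂_ne_zero {τ : ℂ} (hτ : 0 < τ.im) : ∃ z, jacobiTheta₂ z τ ≠ 0 := by
  by_contra! h
  simpa [h] using integral_jacobiTheta₂ hτ

/-! ### The functions `Th0` and `Th1` -/

theorem Th0_eq (τ u : ℂ) : Th0 τ u = jacobiTheta₂ (2 * u) (2 * τ) := by
  refine tsum_congr fun m ↦ ?_
  rw [jacobiTheta₂_term]
  ring_nf

theorem Th1_term_eq (τ u : ℂ) (m : ℤ) :
    exp (2 * Real.pi * I * τ * ((m : ℂ) + 1 / 2) ^ 2 + 4 * Real.pi * I * ((m : ℂ) + 1 / 2) * u) =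
      exp (Real.pi * I * τ / 2 + 2 * Real.pi * I * u) *
        jacobiTheta₂_term m (2 * u + τ) (2 * τ) := by
  rw [jacobiTheta₂_term, ← exp_add]
  ring_nf

theorem Th1_eq (τ u : ℂ) : Th1 τ u =
    exp (Real.pi * I * τ / 2 + 2 * Real.pi * I * u) * jacobiTheta₂ (2 * u + τ) (2 * τ) := by
  rw [jacobiTheta₂, ← tsum_mul_left]
  exact tsum_congr (Th1_term_eq τ u)

theorem im_two_mul_pos {τ : ℂ} (hτ : 0 < τ.im) : 0 < (2 * τ).im := by simpa using hτ

theorem differentiable_Th0 {τ : ℂ} (hτ : 0 < τ.im) : Differentiable ℂ (Th0 τ) := by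
  rw [funext (Th0_eq τ)]
  intro u
  exact (differentiableAt_jacobiTheta₂_fst (2 * u) (im_two_mul_pos hτ)).comp u
    (by fun_prop : DifferentiableAt ℂ (fun u : ℂ ↦ 2 * u) u)

theorem differentiable_Th1 {τ : ℂ} (hτ : 0 < τ.im) : Differentiable ℂ (Th1 τ) := by
  rw [funext (Th1_eq τ)]
  intro u
  refine DifferentiableAt.mul (by fun_prop) ?_
  exact (differentiableAt_jacobiTheta₂_fst (2 * u + τ) (im_two_mul_pos hτ)).comp u
    (by fun_prop : DifferentiableAt ℂ (fun u : ℂ ↦ 2 * u + τ) u)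

theorem Th0_neg (τ u : ℂ) : Th0 τ (-u) = Th0 τ u := by
  rw [Th0_eq, Th0_eq, mul_neg, jacobiTheta₂_neg_left]

theorem Th1_neg (τ u : ℂ) : Th1 τ (-u) = Th1 τ u := by
  rw [Th1, Th1, ← ((Equiv.neg ℤ).trans (Equiv.subRight 1)).tsum_eq]
  refine tsum_congr fun m ↦ ?_
  simp only [Equiv.trans_apply, Equiv.neg_apply, Equiv.subRight_apply]
  push_cast
  ring_nf

theorem Th0_add_half (τ u : ℂ) : Th0 τ (u + 1 / 2) = Th0 τ u := by
  rw [Th0_eq, Th0_eq, show 2 * (u + 1 / 2) = 2 * u + 1 by ring, jacobiTheta₂_add_left]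

theorem Th1_add_half (τ u : ℂ) : Th1 τ (u + 1 / 2) = -Th1 τ u := by
  rw [Th1_eq, Th1_eq, show 2 * (u + 1 / 2) + τ = 2 * u + τ + 1 by ring, jacobiTheta₂_add_left,
    show Real.pi * I * τ / 2 + 2 * Real.pi * I * (u + 1 / 2) =
      Real.pi * I * τ / 2 + 2 * Real.pi * I * u + Real.pi * I by ring, exp_add _ (Real.pi * I),
    exp_pi_mul_I]
  ring

theorem Th0_add_tau_half (τ u : ℂ) :
    Th0 τ (u + τ / 2) = exp (-(Real.pi * I * τ / 2 + 2 * Real.pi * I * u)) * Th1 τ u := by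
  rw [Th0_eq, Th1_eq, ← mul_assoc, ← exp_add, neg_add_cancel, exp_zero, one_mul]
  ring_nf

theorem Th1_add_tau_half (τ u : ℂ) :
    Th1 τ (u + τ / 2) = exp (-(Real.pi * I * τ / 2 + 2 * Real.pi * I * u)) * Th0 τ u := by
  rw [Th1_eq, Th0_eq, show 2 * (u + τ / 2) + τ = 2 * u + 2 * τ by ring, jacobiTheta₂_add_left',
    ← mul_assoc, ← exp_add]
  ring_nf

/-- Translating by a lattice vector multiplies `Th0` and `Th1` by a common factor. -/
theorem exists_Th_add_lattice (τ u : ℂ) {l : ℂ} (hl : inLattice τ l) :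
    ∃ c, Th0 τ (u + l) = c * Th0 τ u ∧ Th1 τ (u + l) = c * Th1 τ u := by
  obtain ⟨m, n, rfl⟩ := hl
  have hexp : ∀ (k : ℤ) (z : ℂ), exp (z + k * (2 * Real.pi * I)) = exp z := fun k z ↦ by
    rw [exp_add, exp_int_mul_two_pi_mul_I, mul_one]
  refine ⟨exp (-(2 * Real.pi * I * τ * n ^ 2 + 4 * Real.pi * I * n * u)), ?_, ?_⟩
  · rw [Th0, Th0, ← (Equiv.addRight n).tsum_eq (fun k : ℤ ↦ exp (2 * Real.pi * I * τ * (k : ℂ) ^ 2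
      + 4 * Real.pi * I * (k : ℂ) * u)), ← tsum_mul_left]
    refine tsum_congr fun k ↦ ?_
    rw [← exp_add, ← hexp (-(2 * k * m))]
    simp only [Equiv.coe_addRight]
    congr 1
    push_cast
    ring
  · rw [Th1, Th1, ← (Equiv.addRight n).tsum_eq (fun k : ℤ ↦ exp (2 * Real.pi * I * τ *
      ((k : ℂ) + 1 / 2) ^ 2 + 4 * Real.pi * I * ((k : ℂ) + 1 / 2) * u)), ← tsum_mul_left]
    refine tsum_congr fun k ↦ ?_
    rw [← exp_add, ← hexp (-((2 * k + 1) * m))]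
    simp only [Equiv.coe_addRight]
    congr 1
    push_cast
    ring

theorem summable_norm_Th0 {τ : ℂ} (hτ : 0 < τ.im) (u : ℂ) :
    Summable fun m : ℤ ↦ ‖exp (2 * Real.pi * I * τ * (m : ℂ) ^ 2
      + 4 * Real.pi * I * (m : ℂ) * u)‖ := by
  refine (summable_norm_jacobiTheta₂_term (2 * u) (im_two_mul_pos hτ)).congr fun m ↦ ?_
  rw [jacobiTheta₂_term]
  ring_nf

theorem summable_norm_Th1 {τ : ℂ} (hτ : 0 < τ.im) (u : ℂ) :
    Summable fun m : ℤ ↦ ‖exp (2 * Real.pi * I * τ * ((m : ℂ) + 1 / 2) ^ 2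
      + 4 * Real.pi * I * ((m : ℂ) + 1 / 2) * u)‖ := by
  simp only [Th1_term_eq, norm_mul]
  exact (summable_norm_jacobiTheta₂_term (2 * u + τ) (im_two_mul_pos hτ)).mul_left _

theorem hasSum_Th0 {τ : ℂ} (hτ : 0 < τ.im) (u : ℂ) :
    HasSum (fun m : ℤ ↦ exp (2 * Real.pi * I * τ * (m : ℂ) ^ 2
      + 4 * Real.pi * I * (m : ℂ) * u)) (Th0 τ u) :=
  (summable_norm_Th0 hτ u).of_norm.hasSum

theorem hasSum_Th1 {τ : ℂ} (hτ : 0 < τ.im) (u : ℂ) :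
    HasSum (fun m : ℤ ↦ exp (2 * Real.pi * I * τ * ((m : ℂ) + 1 / 2) ^ 2
      + 4 * Real.pi * I * ((m : ℂ) + 1 / 2) * u)) (Th1 τ u) :=
  (summable_norm_Th1 hτ u).of_norm.hasSum

theorem injective_add_add_sub (c : ℤ) :
    Function.Injective fun p : ℤ × ℤ ↦ (p.1 + p.2 + c, p.1 - p.2) := by
  rintro ⟨p, q⟩ ⟨p', q'⟩ h
  simp only [Prod.mk.injEq] at h ⊢
  omega

theorem isCompl_range_add_add_sub :
    IsCompl (Set.range fun p : ℤ × ℤ ↦ (p.1 + p.2 + 0, p.1 - p.2))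
      (Set.range fun p : ℤ × ℤ ↦ (p.1 + p.2 + 1, p.1 - p.2)) := by
  refine IsCompl.of_eq (Set.eq_empty_iff_forall_notMem.2 ?_) (Set.eq_univ_iff_forall.2 ?_)
  · rintro ⟨m, n⟩ ⟨⟨⟨p, q⟩, h⟩, ⟨⟨p', q'⟩, h'⟩⟩
    simp only [Prod.mk.injEq] at h h'
    omega
  · rintro ⟨m, n⟩
    rcases Int.even_or_odd' (m + n) with ⟨k, hk | hk⟩
    · exact Or.inl ⟨(k, m - k), by simp only [Prod.mk.injEq]; omega⟩
    · exact Or.inr ⟨(k, m - 1 - k), by simp only [Prod.mk.injEq]; omega⟩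

/-- A sum over `ℤ × ℤ` splits according to the parity of the sum of the two indices. -/
theorem HasSum.of_add_sub_parity {f : ℤ × ℤ → ℂ} {a b : ℂ}
    (h₀ : HasSum (fun p : ℤ × ℤ ↦ f (p.1 + p.2 + 0, p.1 - p.2)) a)
    (h₁ : HasSum (fun p : ℤ × ℤ ↦ f (p.1 + p.2 + 1, p.1 - p.2)) b) : HasSum f (a + b) :=
  HasSum.add_isCompl isCompl_range_add_add_sub
    ((injective_add_add_sub 0).hasSum_range_iff.2 h₀)
    ((injective_add_add_sub 1).hasSum_range_iff.2 h₁)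

theorem hasSum_mul_of_summable_norm {f g : ℤ → ℂ} {a b : ℂ} (hf : HasSum f a) (hg : HasSum g b)
    (hf' : Summable fun n ↦ ‖f n‖) (hg' : Summable fun n ↦ ‖g n‖) :
    HasSum (fun p : ℤ × ℤ ↦ f p.1 * g p.2) (a * b) :=
  hf.mul hg (summable_mul_of_summable_norm hf' hg')

/-- Riemann's addition relation for `jacobiTheta₂`. -/
theorem jacobiTheta₂_add_mul_sub {τ : ℂ} (hτ : 0 < τ.im) (x y : ℂ) :
    jacobiTheta₂ (x + y) τ * jacobiTheta₂ (x - y) τ =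
      Th0 τ x * Th0 τ y + Th1 τ x * Th1 τ y := by
  have hsum := hasSum_mul_of_summable_norm
    (hasSum_jacobiTheta₂_term (x + y) hτ) (hasSum_jacobiTheta₂_term (x - y) hτ)
    (summable_norm_jacobiTheta₂_term (x + y) hτ) (summable_norm_jacobiTheta₂_term (x - y) hτ)
  have h₀ := hasSum_mul_of_summable_norm (hasSum_Th0 hτ x) (hasSum_Th0 hτ y)
    (summable_norm_Th0 hτ x) (summable_norm_Th0 hτ y)
  have h₁ := hasSum_mul_of_summable_norm (hasSum_Th1 hτ x) (hasSum_Th1 hτ y)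
    (summable_norm_Th1 hτ x) (summable_norm_Th1 hτ y)
  refine hsum.unique (HasSum.of_add_sub_parity (h₀.congr_fun ?_) (h₁.congr_fun ?_))
  all_goals
    rintro ⟨p, q⟩
    simp only [jacobiTheta₂_term, ← exp_add]
    congr 1
    push_cast
    ring

theorem jacobiTheta₂_half_period_mul {τ : ℂ} (hτ : 0 < τ.im) (x y : ℂ) :
    jacobiTheta₂ (y + x + (1 + τ) / 2) τ * jacobiTheta₂ (y - x + (1 + τ) / 2) τ =
      exp (-(Real.pi * I * τ / 2 + 2 * Real.pi * I * y)) *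
        (Th0 τ x * Th1 τ y - Th1 τ x * Th0 τ y) := by
  have hy : y + (1 + τ) / 2 = y + τ / 2 + 1 / 2 := by ring
  have h₀ : Th0 τ (y + (1 + τ) / 2) =
      exp (-(Real.pi * I * τ / 2 + 2 * Real.pi * I * y)) * Th1 τ y := by
    rw [hy, Th0_add_half, Th0_add_tau_half]
  have h₁ : Th1 τ (y + (1 + τ) / 2) =
      -(exp (-(Real.pi * I * τ / 2 + 2 * Real.pi * I * y)) * Th0 τ y) := by
    rw [hy, Th1_add_half, Th1_add_tau_half]
  have h := jacobiTheta₂_add_mul_sub hτ (y + (1 + τ) / 2) x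
  rw [h₀, h₁, show y + (1 + τ) / 2 + x = y + x + (1 + τ) / 2 by ring,
    show y + (1 + τ) / 2 - x = y - x + (1 + τ) / 2 by ring] at h
  rw [h]
  ring

theorem differentiable_jacobiTheta₂_fst {τ : ℂ} (hτ : 0 < τ.im) :
    Differentiable ℂ (jacobiTheta₂ · τ) :=
  fun z ↦ differentiableAt_jacobiTheta₂_fst z hτ

/-- The functions `Th0 τ` and `Th1 τ` have no common zero. -/
theorem Th0_ne_zero_or_Th1_ne_zero {τ : ℂ} (hτ : 0 < τ.im) (c : ℂ) :
    Th0 τ c ≠ 0 ∨ Th1 τ c ≠ 0 := by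
  by_contra! hc
  obtain ⟨z, hz⟩ := exists_jacobiTheta₂_ne_zero hτ
  have hT := differentiable_jacobiTheta₂_fst hτ
  have hprod : ∀ y, jacobiTheta₂ (c + y) τ * jacobiTheta₂ (c - y) τ = 0 := fun y ↦ by
    rw [jacobiTheta₂_add_mul_sub hτ, hc.1, hc.2, zero_mul, zero_mul, add_zero]
  rcases entire_eq_zero_or_eq_zero (hT.comp (by fun_prop : Differentiable ℂ fun y ↦ c + y))
    (hT.comp (by fun_prop : Differentiable ℂ fun y ↦ c - y)) hprod with h | h
  · exact hz (by simpa using h (z - c))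
  · exact hz (by simpa using h (c - z))

/-- The zeros of `jacobiTheta₂ · τ` are the translates of `(1 + τ) / 2` by lattice
vectors. -/
theorem inLattice_of_jacobiTheta₂_eq_zero {τ : ℂ} (hτ : 0 < τ.im) {a : ℂ}
    (ha : jacobiTheta₂ (a + (1 + τ) / 2) τ = 0) : inLattice τ a := by
  have hne := Th0_ne_zero_or_Th1_ne_zero hτ
  have d₀ := differentiable_Th0 hτ
  have d₁ := differentiable_Th1 hτ
  have hadd : Differentiable ℂ fun x ↦ x + a := by fun_prop
  have hprop : ∀ x, Th0 τ x * Th1 τ (x + a) = Th1 τ x * Th0 τ (x + a) := fun x ↦ by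
    have h := jacobiTheta₂_half_period_mul hτ x (x + a)
    rw [show x + a - x = a by ring, ha, mul_zero] at h
    have h' := (mul_eq_zero.1 h.symm).resolve_left (exp_ne_zero _)
    linear_combination h'
  obtain ⟨g, hg, hgf⟩ := exists_entire_factor d₀ d₁ (d₀.comp hadd) (d₁.comp hadd) hne hprop
  simp only [Function.comp_apply] at hgf
  have hg₀ : ∀ x, g x ≠ 0 := fun x hx ↦ by
    have := hgf x
    rw [hx, zero_mul, zero_mul] at this
    exact (hne (x + a)).elim (· this.1) (· this.2)
  have half : ∀ x, g (x + 1 / 2) = g x := fun x ↦ by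
    have h := hgf (x + 1 / 2)
    rw [show x + 1 / 2 + a = x + a + 1 / 2 by ring, Th0_add_half, Th1_add_half, Th0_add_half,
      Th1_add_half, (hgf x).1, (hgf x).2] at h
    rcases hne x with hx | hx
    · exact (mul_right_cancel₀ hx h.1).symm
    · exact (mul_right_cancel₀ hx (by linear_combination -h.2)).symm
  have tau_half : ∀ x, g (x + τ / 2) = exp (-(2 * Real.pi * I * a)) * g x := fun x ↦ by
    have h := hgf (x + τ / 2)
    rw [show x + τ / 2 + a = x + a + τ / 2 by ring, Th0_add_tau_half, Th1_add_tau_half,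
      Th0_add_tau_half, Th1_add_tau_half, (hgf x).1, (hgf x).2,
      show -(Real.pi * I * τ / 2 + 2 * Real.pi * I * (x + a)) =
        -(Real.pi * I * τ / 2 + 2 * Real.pi * I * x) + -(2 * Real.pi * I * a) by ring, exp_add] at h
    refine mul_left_cancel₀ (exp_ne_zero (-(Real.pi * I * τ / 2 + 2 * Real.pi * I * x))) ?_
    rcases hne x with hx | hx
    · exact mul_right_cancel₀ hx (by linear_combination -h.2)
    · exact mul_right_cancel₀ hx (by linear_combination -h.1)
  obtain ⟨l, hl⟩ := exists_eq_exp_of_multipliers hτ hg hg₀ (a := 1)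
    (b := exp (-(2 * Real.pi * I * a)) * exp (-(2 * Real.pi * I * a)))
    (fun x ↦ by rw [show x + 1 = x + 1 / 2 + 1 / 2 by ring, half, half, one_mul])
    (fun x ↦ by rw [show x + τ = x + τ / 2 + τ / 2 by ring, tau_half, tau_half]; exact (mul_assoc _ _ _).symm)
  have e₁ : exp (l * (1 / 2)) = 1 := by
    have := half 0
    rw [zero_add, hl] at this
    exact mul_left_cancel₀ (hg₀ 0) (by rw [this, mul_one])
  have e₂ : exp (l * (τ / 2)) = exp (-(2 * Real.pi * I * a)) := by
    have := tau_half 0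
    rw [zero_add, hl] at this
    exact mul_left_cancel₀ (hg₀ 0) (by rw [this, mul_comm])
  obtain ⟨k, hk⟩ := exp_eq_one_iff.1 e₁
  obtain ⟨n, hn⟩ := exp_eq_exp_iff_exists_int.1 e₂
  refine ⟨n, -k, mul_left_cancel₀ two_pi_I_ne_zero ?_⟩
  push_cast
  linear_combination hn - τ * hk

/-- `Θ₀(u)Θ₁(u') = Θ₁(u)Θ₀(u')` holds iff `u' − u ∈ Λ_τ` or
`u' + u − (1 + τ) ∈ Λ_τ`, i.e. the map `Φ₁ : ℂ/Λ_τ → ℙ¹`, `u ↦ (Θ₀(u) : −Θ₁(u))`,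
is a branched double cover whose fiber through `u` is `{u, 1 + τ − u}`. -/
theorem theta_double_cover_one (τ : ℂ) (hτ : 0 < τ.im) (u u' : ℂ) :
    Th0 τ u * Th1 τ u' = Th1 τ u * Th0 τ u' ↔
      inLattice τ (u' - u) ∨ inLattice τ (u' + u - (1 + τ)) := by
  have hfiber : ∀ v w : ℂ, inLattice τ (v + w) →
      Th0 τ w * Th1 τ v = Th1 τ w * Th0 τ v := fun v w h ↦ by
    obtain ⟨c, h₀, h₁⟩ := exists_Th_add_lattice τ (-w) h
    rw [show -w + (v + w) = v by ring, Th0_neg] at h₀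
    rw [show -w + (v + w) = v by ring, Th1_neg] at h₁
    rw [h₀, h₁]
    ring
  have hshift : inLattice τ (u' + u - (1 + τ)) ↔ inLattice τ (u' + u) := by
    constructor <;> rintro ⟨m, n, h⟩
    · exact ⟨m + 1, n + 1, by push_cast; linear_combination h⟩
    · exact ⟨m - 1, n - 1, by push_cast; linear_combination h⟩
  rw [hshift]
  constructor
  · intro h
    have hprod := jacobiTheta₂_half_period_mul hτ u u'
    rw [h, sub_self, mul_zero, mul_eq_zero] at hprod
    exact hprod.symm.imp (inLattice_of_jacobiTheta₂_eq_zero hτ)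
      (inLattice_of_jacobiTheta₂_eq_zero hτ)
  · rintro (h | h)
    · rw [← Th0_neg τ u, ← Th1_neg τ u]
      exact hfiber u' (-u) (by rwa [← sub_eq_add_neg])
    · exact hfiber u' u h
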